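/- Let d, N ≥ 1, T > 0, and let G : P_2(ℝ^d) → ℝ be Lipschitz continuous with respect to d_1 with constant L_G, i.e. |G(μ) − G(ν)| ≤ L_G d_1(μ,ν) for all μ, ν ∈ P_2(ℝ^d). Then for every t ∈ [0,T) and x ∈ (ℝ^d)^N: (i) there exists ν̄ ∈ P_2(ℝ^d) with G(ν̄) + d_2(m_x^N, ν̄)²/(2(T−t)) = U(t, m_x^N) = min_{ν ∈ P_2(ℝ^d)} { G(ν) + d_2(m_x^N, ν)²/(2(T−t)) }; and (ii) every such minimizer ν̄ satisfies V^N(t, x) ≤ U(t, m_x^N) + 4 L_G ε_N(ν̄), where ε_N(ν) := inf_{y ∈ (ℝ^d)^N} d_2(m_y^N, ν). -/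

import Mathlib

open MeasureTheory Filter
open scoped ENNReal NNReal BigOperators

noncomputable section

/-- `Ed d` is the Euclidean space `ℝ^d`. -/
abbrev Ed (d : ℕ) := EuclideanSpace ℝ (Fin d)

/-- A Borel probability measure on `ℝ^d` with finite second moment,
i.e. an element of `P_2(ℝ^d)`. -/
def IsP2 {d : ℕ} (μ : Measure (Ed d)) : Prop :=
  IsProbabilityMeasure μ ∧ Integrable (fun x => ‖x‖ ^ 2) μ

/-- The empirical measure `m_x^N = (1/N) ∑ δ_{x^i}`. -/
def empMeas {d N : ℕ} (x : Fin N → Ed d) : Measure (Ed d) :=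
  (N : ℝ≥0∞)⁻¹ • ∑ i, Measure.dirac (x i)

/-- `π` is a coupling of `μ` and `ν`. -/
def IsCoupling {d : ℕ} (π : Measure (Ed d × Ed d)) (μ ν : Measure (Ed d)) : Prop :=
  IsProbabilityMeasure π ∧ π.map Prod.fst = μ ∧ π.map Prod.snd = ν

/-- The squared 2-Wasserstein distance `d_2(μ,ν)²`, as the infimum over couplings of
`∫ |x - y|² dπ(x,y)` (with value in `[0,∞]`). -/
def d2sq {d : ℕ} (μ ν : Measure (Ed d)) : ℝ≥0∞ :=
  ⨅ (π : Measure (Ed d × Ed d)) (_ : IsCoupling π μ ν),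
    ∫⁻ p, (‖p.1 - p.2‖₊ : ℝ≥0∞) ^ 2 ∂π

/-- The 2-Wasserstein distance `d_2(μ,ν)`. -/
def d2 {d : ℕ} (μ ν : Measure (Ed d)) : ℝ := Real.sqrt (d2sq μ ν).toReal

/-- The 1-Wasserstein distance, via Kantorovich duality:
`d_1(μ,ν) = sup { ∫ f dμ - ∫ f dν : f 1-Lipschitz }`. -/
def d1 {d : ℕ} (μ ν : Measure (Ed d)) : ℝ :=
  sSup { r | ∃ f : Ed d → ℝ, LipschitzWith 1 f ∧ r = (∫ x, f x ∂μ) - ∫ x, f x ∂ν }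

/-- The Hopf–Lax mean-field value function
`U(t,m) = inf_{ν ∈ P_2} { G(ν) + d_2(m,ν)²/(2(T-t)) }`. -/
def MFval {d : ℕ} (T : ℝ) (G : Measure (Ed d) → ℝ) (t : ℝ) (m : Measure (Ed d)) : ℝ :=
  sInf { r | ∃ ν : Measure (Ed d), IsP2 ν ∧
    r = G ν + (d2sq m ν).toReal / (2 * (T - t)) }

/-- The Hopf–Lax `N`-particle value function
`V^N(t,x) = inf_y { G(m_y^N) + (1/(2(T-t)N)) ∑ |x^i - y^i|² }`. -/
def NPval {d N : ℕ} (T : ℝ) (G : Measure (Ed d) → ℝ) (t : ℝ) (x : Fin N → Ed d) : ℝ :=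
  sInf { r | ∃ y : Fin N → Ed d,
    r = G (empMeas y) + (1 / (2 * (T - t) * (N : ℝ))) * ∑ i, ‖x i - y i‖ ^ 2 }

/-- The quantization error `ε_N(ν) = inf_{y ∈ (ℝ^d)^N} d_2(m_y^N, ν)`. -/
def quantErr {d : ℕ} (N : ℕ) (ν : Measure (Ed d)) : ℝ :=
  ⨅ y : Fin N → Ed d, d2 (empMeas y) ν

open ProbabilityTheory Topology

/-- The quadratic transport cost of a plan. -/
def transportCost {d : ℕ} (π : Measure (Ed d × Ed d)) : ℝ≥0∞ :=
  ∫⁻ p, (‖p.1 - p.2‖₊ : ℝ≥0∞) ^ 2 ∂π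

lemma lintegral_nnnorm_sq_eq {α E : Type*} [MeasurableSpace α] [NormedAddCommGroup E]
    (f : α → E) (μ : Measure α) :
    ∫⁻ a, (‖f a‖₊ : ℝ≥0∞) ^ 2 ∂μ = eLpNorm f 2 μ ^ 2 := by
  have h := eLpNorm_nnreal_pow_eq_lintegral (f := f) (μ := μ) (p := 2) (by norm_num)
  simp only [NNReal.coe_ofNat, ENNReal.rpow_ofNat] at h
  exact h.symm

lemma IsP2.memLp {d : ℕ} {μ : Measure (Ed d)} (h : IsP2 μ) : MemLp (fun x => x) 2 μ :=
  (memLp_two_iff_integrable_sq_norm aestronglyMeasurable_id).2 h.2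

lemma IsCoupling.memLp_sub {d : ℕ} {μ ν : Measure (Ed d)} {π : Measure (Ed d × Ed d)}
    (h : IsCoupling π μ ν) (hμ : IsP2 μ) (hν : IsP2 ν) :
    MemLp (fun p : Ed d × Ed d => p.1 - p.2) 2 π := by
  have h1 := hμ.memLp
  have h2 := hν.memLp
  rw [← h.2.1] at h1
  rw [← h.2.2] at h2
  exact (h1.comp_of_map measurable_fst.aemeasurable).sub
    (h2.comp_of_map measurable_snd.aemeasurable)

lemma IsCoupling.transportCost_ne_top {d : ℕ} {μ ν : Measure (Ed d)} {π : Measure (Ed d × Ed d)}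
    (h : IsCoupling π μ ν) (hμ : IsP2 μ) (hν : IsP2 ν) : transportCost π ≠ ∞ := by
  rw [transportCost, lintegral_nnnorm_sq_eq]
  exact ENNReal.pow_ne_top (h.memLp_sub hμ hν).eLpNorm_ne_top

lemma IsP2.integrable_lipschitz {d : ℕ} {μ : Measure (Ed d)} (h : IsP2 μ) {f : Ed d → ℝ}
    (hf : LipschitzWith 1 f) : Integrable f μ := by
  have := h.1
  have h1 : Integrable (fun x : Ed d => x) μ := h.memLp.integrable (by norm_num)
  refine (h1.norm.add (integrable_const |f 0|)).mono' hf.continuous.aestronglyMeasurable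
    (Eventually.of_forall fun x => ?_)
  have h2 := hf.dist_le_mul x 0
  rw [Real.dist_eq, dist_zero_right] at h2
  simp only [NNReal.coe_one, one_mul] at h2
  simp only [Pi.add_apply, Real.norm_eq_abs]
  have := abs_sub_abs_le_abs_sub (f x) (f 0)
  linarith

lemma d1_le_of_forall {d : ℕ} {μ ν : Measure (Ed d)} {r : ℝ}
    (h : ∀ f : Ed d → ℝ, LipschitzWith 1 f → (∫ x, f x ∂μ) - ∫ x, f x ∂ν ≤ r) :
    d1 μ ν ≤ r := by
  refine csSup_le ⟨0, fun _ => 0, LipschitzWith.const' 0 |>.weaken zero_le_one, by simp⟩ ?_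
  rintro _ ⟨f, hf, rfl⟩
  exact h f hf

lemma IsCoupling.integral_sub_le {d : ℕ} {μ ν : Measure (Ed d)} {π : Measure (Ed d × Ed d)}
    (h : IsCoupling π μ ν) (hμ : IsP2 μ) (hν : IsP2 ν) {f : Ed d → ℝ} (hf : LipschitzWith 1 f) :
    (∫ x, f x ∂μ) - ∫ x, f x ∂ν ≤ √(transportCost π).toReal := by
  have := h.1
  have i1 := hμ.integrable_lipschitz hf
  have i2 := hν.integrable_lipschitz hf
  have hm := h.memLp_sub hμ hν
  rw [← h.2.1] at i1
  rw [← h.2.2] at i2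
  rw [← h.2.1, ← h.2.2, integral_map measurable_fst.aemeasurable i1.1,
    integral_map measurable_snd.aemeasurable i2.1,
    ← integral_sub (f := fun p : Ed d × Ed d => f p.1) (g := fun p : Ed d × Ed d => f p.2)
      (i1.comp_measurable measurable_fst) (i2.comp_measurable measurable_snd)]
  calc ∫ p, f p.1 - f p.2 ∂π ≤ ∫ p, ‖p.1 - p.2‖ ∂π := by
        refine integral_mono ((i1.comp_measurable measurable_fst).sub
          (i2.comp_measurable measurable_snd)) (hm.integrable (by norm_num)).norm fun p => ?_
        have h2 := hf.dist_le_mul p.1 p.2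
        rw [Real.dist_eq, dist_eq_norm] at h2
        simp only [NNReal.coe_one, one_mul] at h2
        exact (le_abs_self _).trans h2
    _ = (eLpNorm (fun p : Ed d × Ed d => p.1 - p.2) 1 π).toReal := by
        rw [integral_norm_eq_lintegral_enorm hm.1, eLpNorm_one_eq_lintegral_enorm]
    _ ≤ (eLpNorm (fun p : Ed d × Ed d => p.1 - p.2) 2 π).toReal :=
        ENNReal.toReal_mono hm.eLpNorm_ne_top
          (eLpNorm_le_eLpNorm_of_exponent_le (by norm_num) hm.1)
    _ = √(transportCost π).toReal := by
        rw [transportCost, lintegral_nnnorm_sq_eq, ENNReal.toReal_pow,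
          Real.sqrt_sq ENNReal.toReal_nonneg]

lemma IsCoupling.d1_le {d : ℕ} {μ ν : Measure (Ed d)} {π : Measure (Ed d × Ed d)}
    (h : IsCoupling π μ ν) (hμ : IsP2 μ) (hν : IsP2 ν) :
    d1 μ ν ≤ √(transportCost π).toReal :=
  d1_le_of_forall fun _ hf => h.integral_sub_le hμ hν hf

lemma isCoupling_prod {d : ℕ} {μ ν : Measure (Ed d)} (hμ : IsP2 μ) (hν : IsP2 ν) :
    IsCoupling (μ.prod ν) μ ν := by
  have := hμ.1
  have := hν.1
  exact ⟨inferInstance, by simp, by simp⟩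

lemma d2sq_le {d : ℕ} {μ ν : Measure (Ed d)} {π : Measure (Ed d × Ed d)}
    (h : IsCoupling π μ ν) : d2sq μ ν ≤ transportCost π :=
  iInf₂_le π h

lemma d2sq_ne_top {d : ℕ} {μ ν : Measure (Ed d)} (hμ : IsP2 μ) (hν : IsP2 ν) :
    d2sq μ ν ≠ ∞ :=
  ne_top_of_le_ne_top ((isCoupling_prod hμ hν).transportCost_ne_top hμ hν)
    (d2sq_le (isCoupling_prod hμ hν))

lemma exists_coupling_lt {d : ℕ} {μ ν : Measure (Ed d)} (hμ : IsP2 μ) (hν : IsP2 ν) {r : ℝ}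
    (h : (d2sq μ ν).toReal < r) :
    ∃ π, IsCoupling π μ ν ∧ (transportCost π).toReal < r := by
  have h1 : d2sq μ ν < ENNReal.ofReal r :=
    (ENNReal.lt_ofReal_iff_toReal_lt (d2sq_ne_top hμ hν)).2 h
  obtain ⟨π, hπ, hc⟩ := by simpa only [d2sq, iInf_lt_iff] using h1
  exact ⟨π, hπ, (ENNReal.lt_ofReal_iff_toReal_lt (hπ.transportCost_ne_top hμ hν)).1 hc⟩

lemma d1_le_d2 {d : ℕ} {μ ν : Measure (Ed d)} (hμ : IsP2 μ) (hν : IsP2 ν) :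
    d1 μ ν ≤ d2 μ ν := by
  by_contra! hlt
  have h0 : 0 ≤ d2 μ ν := Real.sqrt_nonneg _
  obtain ⟨π, hπ, hc⟩ := exists_coupling_lt hμ hν
    (r := d1 μ ν ^ 2) ((Real.sqrt_lt' (h0.trans_lt hlt)).1 hlt)
  exact absurd ((Real.sqrt_lt' (h0.trans_lt hlt)).2 hc) (hπ.d1_le hμ hν).not_gt

/-- The uniform probability measure on `Fin N`. -/
def unifFin (N : ℕ) : Measure (Fin N) := (N : ℝ≥0∞)⁻¹ • ∑ i, Measure.dirac i

lemma lintegral_unifFin {N : ℕ} (f : Fin N → ℝ≥0∞) :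
    ∫⁻ i, f i ∂(unifFin N) = (N : ℝ≥0∞)⁻¹ * ∑ i, f i := by
  simp [unifFin]

lemma isProbabilityMeasure_unifFin {N : ℕ} (hN : 1 ≤ N) :
    IsProbabilityMeasure (unifFin N) := by
  constructor
  have : (N : ℝ≥0∞) ≠ 0 := by simp; omega
  simp [unifFin, ENNReal.inv_mul_cancel this (ENNReal.natCast_ne_top N)]

lemma unifFin_singleton {N : ℕ} (i : Fin N) : unifFin N {i} = (N : ℝ≥0∞)⁻¹ := by
  simp [unifFin, Set.indicator_apply]

lemma map_unifFin {N d : ℕ} (x : Fin N → Ed d) : (unifFin N).map x = empMeas x := by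
  rw [unifFin, empMeas, Measure.map_smul,
    Measure.map_finset_sum (measurable_of_finite x).aemeasurable]
  congr 1
  exact Finset.sum_congr rfl fun i _ => Measure.map_dirac' (measurable_of_finite x) i

lemma isP2_empMeas {N d : ℕ} (hN : 1 ≤ N) (x : Fin N → Ed d) : IsP2 (empMeas x) := by
  have := isProbabilityMeasure_unifFin hN
  have hx := measurable_of_finite x
  rw [← map_unifFin]
  refine ⟨Measure.isProbabilityMeasure_map hx.aemeasurable, ?_⟩
  rw [integrable_map_measure (by fun_prop) hx.aemeasurable]
  exact Integrable.of_finite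

lemma isCoupling_map {α : Type*} [MeasurableSpace α] {d : ℕ} (ρ : Measure α)
    [IsProbabilityMeasure ρ] {f g : α → Ed d} (hf : Measurable f) (hg : Measurable g) :
    IsCoupling (ρ.map fun a => (f a, g a)) (ρ.map f) (ρ.map g) := by
  refine ⟨Measure.isProbabilityMeasure_map (by fun_prop), ?_, ?_⟩
  · rw [Measure.map_map measurable_fst (by fun_prop)]; rfl
  · rw [Measure.map_map measurable_snd (by fun_prop)]; rfl

lemma transportCost_map {α : Type*} [MeasurableSpace α] {d : ℕ} (ρ : Measure α)
    {f g : α → Ed d} (hf : Measurable f) (hg : Measurable g) :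
    transportCost (ρ.map fun a => (f a, g a)) = eLpNorm (fun a => f a - g a) 2 ρ ^ 2 := by
  rw [transportCost, lintegral_nnnorm_sq_eq, eLpNorm_map_measure (by fun_prop) (by fun_prop)]
  rfl

lemma transportCost_unifFin {N d : ℕ} (x y : Fin N → Ed d) :
    (transportCost ((unifFin N).map fun i => (x i, y i))).toReal
      = (1 / (N : ℝ)) * ∑ i, ‖x i - y i‖ ^ 2 := by
  rw [transportCost_map _ (measurable_of_finite x) (measurable_of_finite y),
    ← lintegral_nnnorm_sq_eq, lintegral_unifFin, ENNReal.toReal_mul,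
    ENNReal.toReal_sum fun i _ => by finiteness]
  simp

lemma exists_gluing {X Y Z : Type*} [MeasurableSpace X] [StandardBorelSpace X] [Nonempty X]
    [MeasurableSpace Y] [StandardBorelSpace Y] [Nonempty Y] [MeasurableSpace Z]
    (ρ : Measure (Z × X)) (σ : Measure (Z × Y)) [IsProbabilityMeasure ρ]
    [IsProbabilityMeasure σ] (h : ρ.fst = σ.fst) :
    ∃ Γ : Measure (Z × (X × Y)), IsProbabilityMeasure Γ ∧
      Γ.map (fun p => (p.1, p.2.1)) = ρ ∧ Γ.map (fun p => (p.1, p.2.2)) = σ := by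
  refine ⟨ρ.fst ⊗ₘ (ρ.condKernel ×ₖ σ.condKernel), inferInstance, ?_, ?_⟩
  · have h1 := Measure.compProd_map (μ := ρ.fst) (κ := ρ.condKernel ×ₖ σ.condKernel)
      (measurable_fst : Measurable (Prod.fst : X × Y → X))
    rw [← Kernel.fst_eq, Kernel.fst_prod, ρ.disintegrate] at h1
    exact h1.symm
  · have h1 := Measure.compProd_map (μ := ρ.fst) (κ := ρ.condKernel ×ₖ σ.condKernel)
      (measurable_snd : Measurable (Prod.snd : X × Y → Y))
    rw [← Kernel.snd_eq, Kernel.snd_prod, h, σ.disintegrate, ← h] at h1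
    exact h1.symm

lemma integrable_norm_sq_of_lintegral_le {d : ℕ} {μ : Measure (Ed d)} {C : ℝ≥0}
    (h : ∫⁻ x, (‖x‖₊ : ℝ≥0∞) ^ 2 ∂μ ≤ C) : Integrable (fun x => ‖x‖ ^ 2) μ := by
  refine (memLp_two_iff_integrable_sq_norm aestronglyMeasurable_id).1 ⟨aestronglyMeasurable_id, ?_⟩
  have h1 : eLpNorm (fun x : Ed d => x) 2 μ ^ 2 < ∞ := by
    rw [← lintegral_nnnorm_sq_eq]
    exact h.trans_lt ENNReal.coe_lt_top
  exact (ENNReal.pow_lt_top_iff.1 h1).resolve_right (by norm_num)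

lemma integral_norm_sq_le {d : ℕ} {μ : Measure (Ed d)} {C : ℝ≥0}
    (h : ∫⁻ x, (‖x‖₊ : ℝ≥0∞) ^ 2 ∂μ ≤ C) : ∫ x, ‖x‖ ^ 2 ∂μ ≤ C := by
  rw [integral_eq_lintegral_of_nonneg_ae (Eventually.of_forall fun x => by positivity)
    (by fun_prop)]
  refine ENNReal.toReal_le_of_le_ofReal C.2 ?_
  convert h using 2
  · ext x
    rw [ENNReal.ofReal_pow (norm_nonneg _), ofReal_norm]; rfl
  · simp

lemma integral_le_of_levyProkhorovEDist_lt {d : ℕ} {μ ν : Measure (Ed d)}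
    [IsProbabilityMeasure μ] [IsProbabilityMeasure ν] {ε M : ℝ} (hε : 0 < ε)
    (h : levyProkhorovEDist μ ν < ENNReal.ofReal ε) {g : Ed d → ℝ} (hg : LipschitzWith 1 g)
    (hg0 : ∀ x, 0 ≤ g x) (hgM : ∀ x, g x ≤ M) :
    ∫ x, g x ∂μ ≤ ∫ x, g x ∂ν + ε * (1 + M) := by
  have hM : 0 ≤ M := (hg0 0).trans (hgM 0)
  let g' : BoundedContinuousFunction (Ed d) ℝ :=
    BoundedContinuousFunction.ofNormedAddCommGroup g hg.continuous M
      fun x => by rw [Real.norm_of_nonneg (hg0 x)]; exact hgM x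
  let h' : BoundedContinuousFunction (Ed d) ℝ :=
    BoundedContinuousFunction.ofNormedAddCommGroup (fun x => g x + ε)
      (hg.continuous.add continuous_const) (M + ε)
      fun x => by
        rw [Real.norm_of_nonneg (add_nonneg (hg0 x) hε.le)]
        exact add_le_add_left (hgM x) ε
  have hgn : ‖g'‖ ≤ M := BoundedContinuousFunction.norm_ofNormedAddCommGroup_le _ hM _
  have hgh : ‖g'‖ ≤ ‖h'‖ := by
    refine (BoundedContinuousFunction.norm_le (norm_nonneg _)).2 fun x => ?_
    refine le_trans ?_ (h'.norm_coe_le_norm x)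
    change ‖g x‖ ≤ ‖g x + ε‖
    rw [Real.norm_of_nonneg (hg0 x), Real.norm_of_nonneg (add_nonneg (hg0 x) hε.le)]
    linarith
  have key := BoundedContinuousFunction.integral_le_of_levyProkhorovEDist_lt μ ν hε h g'
    (Eventually.of_forall hg0)
  have hlayer := BoundedContinuousFunction.integral_eq_integral_meas_le h' ν
    (Eventually.of_forall fun x => add_nonneg (hg0 x) hε.le)
  have hint (a : ℝ) (s : ℝ → Set (Ed d)) (hs : Antitone s) :
      IntegrableOn (fun t => ν.real (s t)) (Set.Ioc 0 a) volume := by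
    have : Antitone fun t => ν.real (s t) := fun t u htu => measureReal_mono (hs htu)
    exact ((this.antitoneOn _).integrableOn_isCompact isCompact_Icc).mono_set
      Set.Ioc_subset_Icc_self
  have hanti : Antitone fun t : ℝ => {a : Ed d | t ≤ h' a} :=
    fun t u htu a (ha : u ≤ h' a) => htu.trans ha
  have hanti' : Antitone fun t : ℝ => Metric.thickening ε {a : Ed d | t ≤ g' a} :=
    fun t u htu => Metric.thickening_subset_of_subset ε
      fun a (ha : u ≤ g' a) => htu.trans ha
  have hsub (t : ℝ) : Metric.thickening ε {a : Ed d | t ≤ g' a} ⊆ {a | t ≤ h' a} := by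
    intro a ha
    obtain ⟨b, hb, hab⟩ := Metric.mem_thickening_iff.1 ha
    have h1 := hg.dist_le_mul a b
    rw [Real.dist_eq, NNReal.coe_one, one_mul] at h1
    have h2 := neg_abs_le (g a - g b)
    change t ≤ g b at hb
    change t ≤ g a + ε
    linarith
  have h1 : ∫ t in Set.Ioc 0 ‖g'‖, ν.real (Metric.thickening ε {a | t ≤ g' a})
      ≤ ∫ t in Set.Ioc 0 ‖h'‖, ν.real {a | t ≤ h' a} :=
    (setIntegral_mono (hint _ _ hanti') (hint _ _ hanti)
      fun t => measureReal_mono (hsub t)).trans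
      (setIntegral_mono_set (hint _ _ hanti) (Eventually.of_forall fun t => measureReal_nonneg)
        (Set.Ioc_subset_Ioc_right hgh).eventuallyLE)
  have h2 : ∫ x, h' x ∂ν = ∫ x, g x ∂ν + ε := by
    change ∫ x, (g x + ε) ∂ν = _
    rw [integral_add (f := g) (g'.integrable ν) (integrable_const _)]
    simp
  have h3 : ε * ‖g'‖ ≤ ε * M := mul_le_mul_of_nonneg_left hgn hε.le
  change ∫ x, g x ∂μ ≤ _ at key
  linarith

lemma d1_le_of_levyProkhorovEDist_lt {d : ℕ} {μ ν : Measure (Ed d)}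
    [IsProbabilityMeasure μ] [IsProbabilityMeasure ν] {C : ℝ≥0} {ε M : ℝ}
    (hμ : ∫⁻ x, (‖x‖₊ : ℝ≥0∞) ^ 2 ∂μ ≤ C) (hν : ∫⁻ x, (‖x‖₊ : ℝ≥0∞) ^ 2 ∂ν ≤ C)
    (hε : 0 < ε) (hM : 0 < M) (h : levyProkhorovEDist μ ν < ENNReal.ofReal ε) :
    d1 μ ν ≤ 2 * C / M + ε * (1 + 2 * M) := by
  refine d1_le_of_forall fun f hf => ?_
  have iμ := integrable_norm_sq_of_lintegral_le hμ
  have iν := integrable_norm_sq_of_lintegral_le hν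
  have hfμ := IsP2.integrable_lipschitz ⟨inferInstance, iμ⟩ hf
  have hfν := IsP2.integrable_lipschitz ⟨inferInstance, iν⟩ hf
  set g : Ed d → ℝ := fun x => max (-M) (min (f x - f 0) M) + M with hg
  have hgL : LipschitzWith 1 g := by
    have h1 : LipschitzWith 1 fun x => f x - f 0 := by
      refine LipschitzWith.of_dist_le_mul fun x y => ?_
      simpa using hf.dist_le_mul x y
    have h2 := (h1.min_const M).const_max (-M)
    refine LipschitzWith.of_dist_le_mul fun x y => ?_
    simpa [hg] using h2.dist_le_mul x y
  have hg0 (x : Ed d) : 0 ≤ g x := by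
    have := le_max_left (-M) (min (f x - f 0) M)
    simp only [hg]; linarith
  have hgM (x : Ed d) : g x ≤ 2 * M := by
    have : max (-M) (min (f x - f 0) M) ≤ M := max_le (by linarith) (min_le_right _ _)
    simp only [hg]; linarith
  have htrunc (x : Ed d) : |f x - (g x + (f 0 - M))| ≤ ‖x‖ ^ 2 / M := by
    have h1 : |f x - f 0| ≤ ‖x‖ := by simpa [Real.dist_eq] using hf.dist_le_mul x 0
    have h2 : |f x - f 0| ^ 2 ≤ ‖x‖ ^ 2 := by gcongr
    rw [sq_abs] at h2
    have h3 : f x - (g x + (f 0 - M)) = (f x - f 0) - max (-M) (min (f x - f 0) M) := by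
      simp only [hg]; ring
    rw [h3, le_div_iff₀ hM]
    refine le_trans ?_ h2
    generalize f x - f 0 = u
    rcases le_total u M with hu | hu
    · rw [min_eq_left hu]
      rcases le_total (-M) u with hu' | hu'
      · rw [max_eq_right hu']; simp [sq_nonneg]
      · rw [max_eq_left hu', abs_of_nonpos (by linarith)]; nlinarith
    · rw [min_eq_right hu, max_eq_right (by linarith), abs_of_nonneg (by linarith)]; nlinarith
  have hgμ := IsP2.integrable_lipschitz ⟨inferInstance, iμ⟩ hgL
  have hgν := IsP2.integrable_lipschitz ⟨inferInstance, iν⟩ hgL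
  have igμ : Integrable (fun x => g x + (f 0 - M)) μ := hgμ.add (integrable_const _)
  have igν : Integrable (fun x => g x + (f 0 - M)) ν := hgν.add (integrable_const _)
  have key := integral_le_of_levyProkhorovEDist_lt hε h hgL hg0 hgM
  have h1 : ∫ x, f x ∂μ ≤ ∫ x, (g x + (f 0 - M) + ‖x‖ ^ 2 / M) ∂μ :=
    integral_mono hfμ (igμ.add (iμ.div_const M)) fun x => by
      have := (abs_le.1 (htrunc x)).2
      simp only []; linarith
  have h2 : ∫ x, (g x + (f 0 - M) - ‖x‖ ^ 2 / M) ∂ν ≤ ∫ x, f x ∂ν :=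
    integral_mono (igν.sub (iν.div_const M)) hfν fun x => by
      have := (abs_le.1 (htrunc x)).1
      simp only []; linarith
  rw [integral_add igμ (iμ.div_const M),
    integral_add hgμ (integrable_const _), integral_div] at h1
  rw [integral_sub igν (iν.div_const M),
    integral_add hgν (integrable_const _), integral_div] at h2
  have h3 : (∫ x, ‖x‖ ^ 2 ∂μ) / M ≤ C / M := by gcongr; exact integral_norm_sq_le hμ
  have h4 : (∫ x, ‖x‖ ^ 2 ∂ν) / M ≤ C / M := by gcongr; exact integral_norm_sq_le hν
  simp only [integral_const, probReal_univ, one_smul] at h1 h2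
  have h5 : 2 * (C : ℝ) / M = C / M + C / M := by ring
  linarith

lemma eventually_d1_le {d : ℕ} {μs : ℕ → ProbabilityMeasure (Ed d)} {μ : ProbabilityMeasure (Ed d)}
    (h : Tendsto μs atTop (𝓝 μ)) {C : ℝ≥0}
    (hs : ∀ n, ∫⁻ x, (‖x‖₊ : ℝ≥0∞) ^ 2 ∂(μs n : Measure (Ed d)) ≤ C)
    (hμ : ∫⁻ x, (‖x‖₊ : ℝ≥0∞) ^ 2 ∂(μ : Measure (Ed d)) ≤ C) {δ : ℝ} (hδ : 0 < δ) :
    ∀ᶠ n in atTop, d1 (μs n : Measure (Ed d)) μ ≤ δ := by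
  set M : ℝ := 4 * (C + 1) / δ with hM
  have hC : (0 : ℝ) ≤ C := C.2
  have hM0 : 0 < M := by positivity
  set ε : ℝ := δ / 2 / (1 + 2 * M) with hε
  have hε0 : 0 < ε := by positivity
  have h1 : Tendsto (fun n => LevyProkhorov.ofMeasure (μs n)) atTop
      (𝓝 (LevyProkhorov.ofMeasure μ)) :=
    (LevyProkhorov.continuous_ofMeasure_probabilityMeasure.tendsto μ).comp h
  filter_upwards [EMetric.tendsto_nhds.1 h1 (ENNReal.ofReal ε) (by simpa using hε0)] with n hn
  rw [LevyProkhorov.edist_probabilityMeasure_def] at hn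
  refine (d1_le_of_levyProkhorovEDist_lt (hs n) hμ hε0 hM0 hn).trans ?_
  have h2 : ε * (1 + 2 * M) = δ / 2 := by rw [hε]; field_simp
  have h3 : 2 * (C : ℝ) / M ≤ δ / 2 := by
    rw [div_le_iff₀ hM0, hM]
    field_simp
    linarith
  linarith

lemma lintegral_le_liminf_of_tendsto {Ω : Type*} [MeasurableSpace Ω] [PseudoEMetricSpace Ω]
    [OpensMeasurableSpace Ω] {μs : ℕ → ProbabilityMeasure Ω} {μ : ProbabilityMeasure Ω}
    (h : Tendsto μs atTop (𝓝 μ)) {E : Type*} [NormedAddCommGroup E] {f : Ω → E}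
    (hf : Continuous f) :
    ∫⁻ x, (‖f x‖₊ : ℝ≥0∞) ^ 2 ∂(μ : Measure Ω)
      ≤ atTop.liminf fun n => ∫⁻ x, (‖f x‖₊ : ℝ≥0∞) ^ 2 ∂(μs n : Measure Ω) := by
  have h1 := lintegral_le_liminf_lintegral_of_forall_isOpen_measure_le_liminf_measure
    (μ := (μ : Measure Ω)) (μs := fun n => (μs n : Measure Ω)) (f := fun x => ‖f x‖ ^ 2)
    (by fun_prop) (fun x => by positivity)
    fun U hU => ProbabilityMeasure.le_liminf_measure_open_of_tendsto h hU
  have h2 (x : Ω) : ENNReal.ofReal (‖f x‖ ^ 2) = (‖f x‖₊ : ℝ≥0∞) ^ 2 := by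
    rw [ENNReal.ofReal_pow (norm_nonneg _), ofReal_norm]; rfl
  simpa only [h2] using h1

lemma isTightMeasureSet_of_lintegral_le {d : ℕ} {S : Set (Measure (Ed d))} {C : ℝ≥0}
    (h : ∀ μ ∈ S, ∫⁻ x, (‖x‖₊ : ℝ≥0∞) ^ 2 ∂μ ≤ C) : IsTightMeasureSet S := by
  rw [isTightMeasureSet_iff_exists_isCompact_measure_compl_le]
  intro ε hε
  obtain ⟨r, hr⟩ : ∃ r : ℝ≥0, (C : ℝ≥0∞) / ε ≤ r := by
    refine ⟨(C / ε).toNNReal, ?_⟩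
    rw [ENNReal.coe_toNNReal (ENNReal.div_ne_top ENNReal.coe_ne_top hε.ne')]
  refine ⟨Metric.closedBall 0 (r + 1), isCompact_closedBall _ _, fun μ hμ => ?_⟩
  have hr0 : ((r + 1 : ℝ≥0) : ℝ≥0∞) ≠ 0 := by simp
  calc μ (Metric.closedBall 0 (r + 1))ᶜ
      ≤ μ {x | ((r + 1 : ℝ≥0) : ℝ≥0∞) ≤ (‖x‖₊ : ℝ≥0∞) ^ 2} := by
        refine measure_mono fun x hx => ?_
        simp only [Set.mem_compl_iff, Metric.mem_closedBall, dist_zero_right, not_le] at hx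
        have h1 : r + 1 ≤ ‖x‖₊ ^ 2 := by
          rw [← NNReal.coe_le_coe]
          push_cast
          nlinarith [r.2]
        show ((r + 1 : ℝ≥0) : ℝ≥0∞) ≤ (‖x‖₊ : ℝ≥0∞) ^ 2
        exact_mod_cast h1
    _ ≤ (∫⁻ x, (‖x‖₊ : ℝ≥0∞) ^ 2 ∂μ) / ((r + 1 : ℝ≥0) : ℝ≥0∞) :=
        meas_ge_le_lintegral_div (by fun_prop) hr0 ENNReal.coe_ne_top
    _ ≤ ε := by
        refine ENNReal.div_le_of_le_mul ((h μ hμ).trans ?_)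
        rcases eq_or_ne ε ∞ with rfl | hε'
        · rw [ENNReal.top_mul hr0]; exact le_top
        · rw [ENNReal.div_le_iff hε.ne' hε'] at hr
          refine hr.trans ?_
          rw [mul_comm]
          gcongr
          simp

lemma exists_perm_sum_le_integral {N : ℕ} (hN : 1 ≤ N) (Θ : Measure (Fin N × Fin N))
    [IsProbabilityMeasure Θ] (h1 : Θ.fst = unifFin N) (h2 : Θ.snd = unifFin N)
    (c : Fin N → Fin N → ℝ) :
    ∃ σ : Equiv.Perm (Fin N), (1 / (N : ℝ)) * ∑ i, c i (σ i) ≤ ∫ p, c p.1 p.2 ∂Θ := by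
  have hN0 : (N : ℝ) ≠ 0 := by positivity
  let M : Matrix (Fin N) (Fin N) ℝ := Matrix.of fun i j => N * Θ.real {(i, j)}
  have hrow (i : Fin N) : ∑ j, Θ.real {(i, j)} = (N : ℝ)⁻¹ := by
    have e1 : Θ.real (Prod.fst ⁻¹' {i}) = (N : ℝ)⁻¹ := by
      rw [measureReal_def, ← Measure.fst_apply (MeasurableSet.singleton i), h1,
        unifFin_singleton]
      simp
    rw [← e1, measureReal_def, measure_preimage_fst_singleton_eq_sum,
      ENNReal.toReal_sum fun _ _ => measure_ne_top _ _]
    rfl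
  have hcol (j : Fin N) : ∑ i, Θ.real {(i, j)} = (N : ℝ)⁻¹ := by
    have e1 : Θ.real (Prod.snd ⁻¹' {j}) = (N : ℝ)⁻¹ := by
      rw [measureReal_def, ← Measure.snd_apply (MeasurableSet.singleton j), h2,
        unifFin_singleton]
      simp
    rw [← e1, measureReal_def, measure_preimage_snd_singleton_eq_sum,
      ENNReal.toReal_sum fun _ _ => measure_ne_top _ _]
    rfl
  have hM : M ∈ doublyStochastic ℝ (Fin N) := by
    rw [mem_doublyStochastic_iff_sum]
    refine ⟨fun i j => mul_nonneg (Nat.cast_nonneg _) measureReal_nonneg, fun i => ?_, fun j => ?_⟩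
    · simp only [M, Matrix.of_apply]
      rw [← Finset.mul_sum, hrow, mul_inv_cancel₀ hN0]
    · simp only [M, Matrix.of_apply]
      rw [← Finset.mul_sum, hcol, mul_inv_cancel₀ hN0]
  obtain ⟨w, hw0, hw1, hwM⟩ := exists_eq_sum_perm_of_mem_doublyStochastic hM
  obtain ⟨σ, hσ⟩ := Finite.exists_min fun σ : Equiv.Perm (Fin N) => ∑ i, c i (σ i)
  refine ⟨σ, ?_⟩
  have hint : ∫ p, c p.1 p.2 ∂Θ = (1 / (N : ℝ)) * ∑ i, ∑ j, M i j * c i j := by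
    rw [integral_fintype Integrable.of_finite, Fintype.sum_prod_type, Finset.mul_sum]
    refine Finset.sum_congr rfl fun i _ => ?_
    rw [Finset.mul_sum]
    refine Finset.sum_congr rfl fun j _ => ?_
    simp only [M, Matrix.of_apply, smul_eq_mul]
    field_simp
  have hsum : ∑ i, ∑ j, M i j * c i j = ∑ τ, w τ * ∑ i, c i (τ i) := by
    have hent (i j : Fin N) : M i j = ∑ τ, w τ * if τ i = j then 1 else 0 := by
      rw [← hwM, Matrix.sum_apply]
      refine Finset.sum_congr rfl fun τ _ => ?_
      simp [Equiv.Perm.permMatrix, PEquiv.toMatrix_apply, eq_comm]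
    calc ∑ i, ∑ j, M i j * c i j = ∑ i, ∑ τ, w τ * c i (τ i) := by
          refine Finset.sum_congr rfl fun i _ => ?_
          simp_rw [hent, Finset.sum_mul]
          rw [Finset.sum_comm]
          refine Finset.sum_congr rfl fun τ _ => ?_
          simp
      _ = ∑ τ, w τ * ∑ i, c i (τ i) := by
          rw [Finset.sum_comm]
          simp_rw [Finset.mul_sum]
  rw [hint, hsum]
  refine mul_le_mul_of_nonneg_left ?_ (by positivity)
  calc ∑ i, c i (σ i) = ∑ τ, w τ * ∑ i, c i (σ i) := by rw [← Finset.sum_mul, hw1, one_mul]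
    _ ≤ ∑ τ, w τ * ∑ i, c i (τ i) :=
        Finset.sum_le_sum fun τ _ => mul_le_mul_of_nonneg_left (hσ τ) (hw0 τ)

lemma IsCoupling.exists_index_lift {N d : ℕ} (hN : 1 ≤ N) {x : Fin N → Ed d}
    {ν : Measure (Ed d)} {π : Measure (Ed d × Ed d)} (h : IsCoupling π (empMeas x) ν) :
    ∃ θ : Measure (Ed d × Fin N), IsProbabilityMeasure θ ∧ θ.fst = ν ∧ θ.snd = unifFin N ∧
      eLpNorm (fun p => x p.2 - p.1) 2 θ ^ 2 = transportCost π := by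
  have := h.1
  have := isProbabilityMeasure_unifFin hN
  have : Nonempty (Fin N) := ⟨⟨0, hN⟩⟩
  have hx := measurable_of_finite x
  have hρ : Measurable fun i => (x i, i) := measurable_of_finite _
  have : IsProbabilityMeasure ((unifFin N).map fun i => (x i, i)) :=
    Measure.isProbabilityMeasure_map hρ.aemeasurable
  obtain ⟨Γ, hΓ, e1, e2⟩ := exists_gluing ((unifFin N).map fun i => (x i, i)) π (by
    rw [Measure.fst, Measure.fst, h.2.1, Measure.map_map measurable_fst hρ]
    exact map_unifFin x)
  have hm : Measurable fun p : Ed d × (Fin N × Ed d) => (p.2.2, p.2.1) := by fun_prop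
  refine ⟨Γ.map fun p => (p.2.2, p.2.1), Measure.isProbabilityMeasure_map hm.aemeasurable,
    ?_, ?_, ?_⟩
  · rw [Measure.fst, Measure.map_map measurable_fst hm, ← h.2.2, ← e2,
      Measure.map_map measurable_snd (by fun_prop)]
    rfl
  · have : ((unifFin N).map fun i => (x i, i)).map Prod.snd = unifFin N := by
      rw [Measure.map_map measurable_snd hρ]
      exact Measure.map_id
    rw [Measure.snd, Measure.map_map measurable_snd hm, ← this, ← e1,
      Measure.map_map measurable_snd (by fun_prop)]
    rfl
  · have hae : ∀ᵐ p ∂Γ, p.1 = x p.2.1 := by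
      have h3 : ∀ᵐ q ∂((unifFin N).map fun i => (x i, i)), q.1 = x q.2 := by
        rw [ae_map_iff hρ.aemeasurable (measurableSet_eq_fun measurable_fst (by fun_prop))]
        exact Eventually.of_forall fun _ => rfl
      rw [← e1] at h3
      exact ae_of_ae_map (by fun_prop) h3
    rw [transportCost, lintegral_nnnorm_sq_eq, eLpNorm_map_measure (by fun_prop) hm.aemeasurable,
      ← e2, eLpNorm_map_measure (by fun_prop) (by fun_prop)]
    congr 1
    refine eLpNorm_congr_ae ?_
    filter_upwards [hae] with p hp
    simp [hp]

lemma exists_perm_sum_norm_sub_sq_le {N d : ℕ} (hN : 1 ≤ N) {x y : Fin N → Ed d}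
    {ν : Measure (Ed d)} (hν : IsP2 ν) {π₁ π₂ : Measure (Ed d × Ed d)}
    (h₁ : IsCoupling π₁ (empMeas x) ν) (h₂ : IsCoupling π₂ (empMeas y) ν) :
    ∃ σ : Equiv.Perm (Fin N), (1 / (N : ℝ)) * ∑ i, ‖x i - y (σ i)‖ ^ 2 ≤
      (√(transportCost π₁).toReal + √(transportCost π₂).toReal) ^ 2 := by
  have : Nonempty (Fin N) := ⟨⟨0, hN⟩⟩
  have hx := measurable_of_finite x
  have hy := measurable_of_finite y
  obtain ⟨θ₁, hp₁, f₁, s₁, c₁⟩ := h₁.exists_index_lift hN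
  obtain ⟨θ₂, hp₂, f₂, s₂, c₂⟩ := h₂.exists_index_lift hN
  obtain ⟨Γ, hΓ, e₁, e₂⟩ := exists_gluing θ₁ θ₂ (f₁.trans f₂.symm)
  have hfst : Γ.snd.fst = unifFin N := by
    rw [← s₁, ← e₁, Measure.snd, Measure.snd, Measure.fst, Measure.map_map, Measure.map_map]
    · rfl
    all_goals fun_prop
  have hsnd : Γ.snd.snd = unifFin N := by
    rw [← s₂, ← e₂, Measure.snd, Measure.snd, Measure.snd, Measure.map_map, Measure.map_map]
    · rfl
    all_goals fun_prop
  obtain ⟨σ, hσ⟩ := exists_perm_sum_le_integral hN Γ.snd hfst hsnd fun i j => ‖x i - y j‖ ^ 2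
  refine ⟨σ, hσ.trans ?_⟩
  have t₁ : √(transportCost π₁).toReal
      = (eLpNorm (fun p : Ed d × (Fin N × Fin N) => x p.2.1 - p.1) 2 Γ).toReal := by
    rw [← c₁, ← e₁, eLpNorm_map_measure (by fun_prop) (by fun_prop), ENNReal.toReal_pow,
      Real.sqrt_sq ENNReal.toReal_nonneg]
    rfl
  have t₂ : √(transportCost π₂).toReal
      = (eLpNorm (fun p : Ed d × (Fin N × Fin N) => y p.2.2 - p.1) 2 Γ).toReal := by
    rw [← c₂, ← e₂, eLpNorm_map_measure (by fun_prop) (by fun_prop), ENNReal.toReal_pow,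
      Real.sqrt_sq ENNReal.toReal_nonneg]
    rfl
  have n₁ : eLpNorm (fun p : Ed d × (Fin N × Fin N) => x p.2.1 - p.1) 2 Γ ≠ ∞ := by
    have := h₁.transportCost_ne_top (isP2_empMeas hN x) hν
    rw [← c₁, ← e₁, eLpNorm_map_measure (by fun_prop) (by fun_prop)] at this
    exact fun h => this (by rw [ENNReal.pow_eq_top_iff]; exact ⟨h, two_ne_zero⟩)
  have n₂ : eLpNorm (fun p : Ed d × (Fin N × Fin N) => y p.2.2 - p.1) 2 Γ ≠ ∞ := by
    have := h₂.transportCost_ne_top (isP2_empMeas hN y) hν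
    rw [← c₂, ← e₂, eLpNorm_map_measure (by fun_prop) (by fun_prop)] at this
    exact fun h => this (by rw [ENNReal.pow_eq_top_iff]; exact ⟨h, two_ne_zero⟩)
  have hint : ∫ p, ‖x p.1 - y p.2‖ ^ 2 ∂Γ.snd
      = (eLpNorm (fun p : Ed d × (Fin N × Fin N) => x p.2.1 - y p.2.2) 2 Γ).toReal ^ 2 := by
    rw [integral_eq_lintegral_of_nonneg_ae (Eventually.of_forall fun p => by positivity)
      (by fun_prop), ← ENNReal.toReal_pow, ← lintegral_nnnorm_sq_eq, Measure.snd,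
      lintegral_map (by fun_prop) measurable_snd]
    congr 1
    refine lintegral_congr fun p => ?_
    rw [ENNReal.ofReal_pow (norm_nonneg _), ofReal_norm]
    rfl
  rw [hint, t₁, t₂, ← ENNReal.toReal_add n₁ n₂]
  refine pow_le_pow_left₀ ENNReal.toReal_nonneg
    (ENNReal.toReal_mono (ENNReal.add_ne_top.2 ⟨n₁, n₂⟩) ?_) 2
  have e3 : (fun p : Ed d × (Fin N × Fin N) => x p.2.1 - y p.2.2)
      = (fun p => x p.2.1 - p.1) - fun p => y p.2.2 - p.1 := by
    ext1 p; simp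
  rw [e3]
  exact eLpNorm_sub_le (by fun_prop) (by fun_prop) (by norm_num)

lemma empMeas_comp_perm {N d : ℕ} (y : Fin N → Ed d) (σ : Equiv.Perm (Fin N)) :
    empMeas (fun i => y (σ i)) = empMeas y := by
  rw [empMeas, empMeas, Equiv.sum_comp σ fun i => Measure.dirac (y i)]

lemma isP2_dirac {d : ℕ} (a : Ed d) : IsP2 (Measure.dirac a) :=
  ⟨inferInstance, integrable_dirac (by simp)⟩

lemma lipschitz_const_nonneg {d : ℕ} (hd : 1 ≤ d) {G : Measure (Ed d) → ℝ} {LG : ℝ}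
    (hG : ∀ μ ν : Measure (Ed d), IsP2 μ → IsP2 ν → |G μ - G ν| ≤ LG * d1 μ ν) : 0 ≤ LG := by
  let e : Ed d := EuclideanSpace.single ⟨0, hd⟩ 1
  have he : ‖e‖ = 1 := by simp [e]
  have hc := isCoupling_prod (isP2_dirac e) (isP2_dirac (0 : Ed d))
  have h1 : 1 ≤ d1 (Measure.dirac e) (Measure.dirac (0 : Ed d)) := by
    refine le_csSup ⟨√(transportCost ((Measure.dirac e).prod (Measure.dirac (0 : Ed d)))).toReal, ?_⟩
      ⟨fun x => ‖x‖, lipschitzWith_one_norm, ?_⟩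
    · rintro _ ⟨f, hf, rfl⟩
      exact hc.integral_sub_le (isP2_dirac _) (isP2_dirac _) hf
    · simp [he]
  have h2 := (abs_nonneg _).trans (hG _ _ (isP2_dirac e) (isP2_dirac 0))
  exact nonneg_of_mul_nonneg_left h2 (by linarith)

lemma coercive_bound {d : ℕ} {G : Measure (Ed d) → ℝ} {LG : ℝ} (hLG : 0 ≤ LG)
    (hG : ∀ μ ν : Measure (Ed d), IsP2 μ → IsP2 ν → |G μ - G ν| ≤ LG * d1 μ ν)
    {μ ν : Measure (Ed d)} (hμ : IsP2 μ) (hν : IsP2 ν) {τ c : ℝ} (hτ : 0 < τ) (hc : 0 ≤ c)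
    (h : d1 μ ν ≤ √c) :
    G μ - LG ^ 2 * τ + c / (4 * τ) ≤ G ν + c / (2 * τ) := by
  have h1 := (abs_le.1 (hG μ ν hμ hν)).2
  have h2 : LG * d1 μ ν ≤ LG * √c := mul_le_mul_of_nonneg_left h hLG
  have h3 : c / (2 * τ) - c / (4 * τ) - LG * √c + LG ^ 2 * τ
      = (√c - 2 * LG * τ) ^ 2 / (4 * τ) := by
    have := Real.sq_sqrt hc
    field_simp
    rw [this.symm]
    simp only [Real.sqrt_sq (Real.sqrt_nonneg c)]
    ring
  have h4 : 0 ≤ (√c - 2 * LG * τ) ^ 2 / (4 * τ) := by positivity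
  linarith

lemma IsCoupling.lintegral_norm_sq_le {d : ℕ} {μ ν : Measure (Ed d)} {π : Measure (Ed d × Ed d)}
    (h : IsCoupling π μ ν) :
    ∫⁻ y, (‖y‖₊ : ℝ≥0∞) ^ 2 ∂ν ≤ 2 * ∫⁻ x, (‖x‖₊ : ℝ≥0∞) ^ 2 ∂μ + 2 * transportCost π := by
  rw [← h.2.1, ← h.2.2, lintegral_map (by fun_prop) measurable_snd,
    lintegral_map (by fun_prop) measurable_fst, transportCost, ← lintegral_const_mul _ (by fun_prop),
    ← lintegral_const_mul _ (by fun_prop), ← lintegral_add_left (by fun_prop)]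
  refine lintegral_mono fun p => ?_
  have h1 : ‖p.2‖₊ ≤ ‖p.1‖₊ + ‖p.1 - p.2‖₊ := by
    simpa using nnnorm_sub_le p.1 (p.1 - p.2)
  have h2 : ‖p.2‖₊ ^ 2 ≤ 2 * ‖p.1‖₊ ^ 2 + 2 * ‖p.1 - p.2‖₊ ^ 2 := by
    rw [← mul_add]
    exact (pow_le_pow_left₀ zero_le h1 2).trans add_sq_le
  have h3 := ENNReal.coe_le_coe.2 h2
  push_cast at h3
  exact h3

lemma exists_subseq_coupling_limit {d : ℕ} {m : Measure (Ed d)} (hm : IsP2 m)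
    {νs : ℕ → Measure (Ed d)} {πs : ℕ → Measure (Ed d × Ed d)}
    (hπ : ∀ n, IsCoupling (πs n) m (νs n)) {K : ℝ≥0} (hK : ∀ n, transportCost (πs n) ≤ K) :
    ∃ (ν : Measure (Ed d)) (π : Measure (Ed d × Ed d)) (φ : ℕ → ℕ), StrictMono φ ∧ IsP2 ν ∧
      IsCoupling π m ν ∧ (∀ δ > 0, ∀ᶠ n in atTop, d1 (νs (φ n)) ν ≤ δ) ∧
      transportCost π ≤ atTop.liminf fun n => transportCost (πs (φ n)) := by
  have hm1 := hm.1
  obtain ⟨A, hA⟩ : ∃ A : ℝ≥0, ∫⁻ x, (‖x‖₊ : ℝ≥0∞) ^ 2 ∂m = A := by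
    refine ⟨(∫⁻ x, (‖x‖₊ : ℝ≥0∞) ^ 2 ∂m).toNNReal, (ENNReal.coe_toNNReal ?_).symm⟩
    rw [lintegral_nnnorm_sq_eq]
    exact ENNReal.pow_ne_top hm.memLp.eLpNorm_ne_top
  have hC (n : ℕ) : ∫⁻ y, (‖y‖₊ : ℝ≥0∞) ^ 2 ∂(νs n) ≤ (2 * A + 2 * K : ℝ≥0) := by
    refine (hπ n).lintegral_norm_sq_le.trans ?_
    rw [hA]
    push_cast
    gcongr
    exact hK n
  let P : ℕ → ProbabilityMeasure (Ed d × Ed d) := fun n => ⟨πs n, (hπ n).1⟩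
  have htight : IsTightMeasureSet
      {((μ : ProbabilityMeasure (Ed d × Ed d)) : Measure (Ed d × Ed d)) | μ ∈ Set.range P} := by
    refine IsTightMeasureSet.prodMk
      (isTightMeasureSet_of_lintegral_le (C := A) ?_)
      (isTightMeasureSet_of_lintegral_le (C := 2 * A + 2 * K) ?_)
    · rintro _ ⟨_, ⟨_, ⟨n, rfl⟩, rfl⟩, rfl⟩
      change ∫⁻ x, (‖x‖₊ : ℝ≥0∞) ^ 2 ∂((πs n).map Prod.fst) ≤ A
      rw [(hπ n).2.1, hA]
    · rintro _ ⟨_, ⟨_, ⟨n, rfl⟩, rfl⟩, rfl⟩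
      change ∫⁻ x, (‖x‖₊ : ℝ≥0∞) ^ 2 ∂((πs n).map Prod.snd) ≤ _
      rw [(hπ n).2.2]
      exact hC n
  obtain ⟨Q, -, φ, hφ, hQ⟩ := (isCompact_closure_of_isTightMeasureSet htight).isSeqCompact
    fun n => subset_closure (Set.mem_range_self n)
  have hfst := ProbabilityMeasure.tendsto_map_of_tendsto_of_continuous _ _ hQ
    (continuous_fst (X := Ed d) (Y := Ed d))
  have hsnd := ProbabilityMeasure.tendsto_map_of_tendsto_of_continuous _ _ hQ
    (continuous_snd (X := Ed d) (Y := Ed d))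
  have hf (n : ℕ) : (P (φ n)).map (continuous_fst (X := Ed d) (Y := Ed d)).measurable.aemeasurable
      = ⟨m, hm1⟩ := Subtype.ext (hπ (φ n)).2.1
  have hs (n : ℕ) : ((P (φ n)).map
      (continuous_snd (X := Ed d) (Y := Ed d)).measurable.aemeasurable : Measure (Ed d))
        = νs (φ n) := (hπ (φ n)).2.2
  have hQm : (Q : Measure (Ed d × Ed d)).map Prod.fst = m := by
    have := tendsto_nhds_unique hfst (by simp only [Function.comp_apply, hf]; exact tendsto_const_nhds)
    exact congrArg Subtype.val this
  have hmom : ∫⁻ y, (‖y‖₊ : ℝ≥0∞) ^ 2 ∂((Q : Measure (Ed d × Ed d)).map Prod.snd)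
      ≤ (2 * A + 2 * K : ℝ≥0) := by
    refine (lintegral_le_liminf_of_tendsto hsnd continuous_id).trans ?_
    refine liminf_le_of_le (by isBoundedDefault) fun b hb => ?_
    obtain ⟨n, hn⟩ := hb.exists
    refine hn.trans ?_
    simp only [Function.comp_apply, hs]
    exact hC _
  refine ⟨_, Q, φ, hφ, ⟨Measure.isProbabilityMeasure_map (by fun_prop),
    integrable_norm_sq_of_lintegral_le hmom⟩, ⟨inferInstance, hQm, rfl⟩, fun δ hδ => ?_, ?_⟩
  · have := eventually_d1_le hsnd (C := 2 * A + 2 * K)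
      (fun n => by simp only [Function.comp_apply, hs]; exact hC _) hmom hδ
    simp only [Function.comp_apply, hs] at this
    exact this
  · exact lintegral_le_liminf_of_tendsto hQ (f := fun p => p.1 - p.2) (by fun_prop)

lemma bddBelow_hopfLax {d : ℕ} {G : Measure (Ed d) → ℝ} {LG : ℝ} (hLG : 0 ≤ LG)
    (hG : ∀ μ ν : Measure (Ed d), IsP2 μ → IsP2 ν → |G μ - G ν| ≤ LG * d1 μ ν)
    {m : Measure (Ed d)} (hm : IsP2 m) {τ : ℝ} (hτ : 0 < τ) :
    BddBelow { r | ∃ ν : Measure (Ed d), IsP2 ν ∧ r = G ν + (d2sq m ν).toReal / (2 * τ) } := by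
  refine ⟨G m - LG ^ 2 * τ, ?_⟩
  rintro _ ⟨ν, hν, rfl⟩
  have := coercive_bound hLG hG hm hν hτ ENNReal.toReal_nonneg (d1_le_d2 hm hν)
  have h2 : 0 ≤ (d2sq m ν).toReal / (4 * τ) := by positivity
  linarith

lemma exists_hopfLax_minimizer {d : ℕ} {G : Measure (Ed d) → ℝ} {LG : ℝ} (hLG : 0 ≤ LG)
    (hG : ∀ μ ν : Measure (Ed d), IsP2 μ → IsP2 ν → |G μ - G ν| ≤ LG * d1 μ ν)
    {m : Measure (Ed d)} (hm : IsP2 m) {τ : ℝ} (hτ : 0 < τ) :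
    ∃ ν : Measure (Ed d), IsP2 ν ∧ G ν + (d2sq m ν).toReal / (2 * τ) =
      sInf { r | ∃ ν : Measure (Ed d), IsP2 ν ∧ r = G ν + (d2sq m ν).toReal / (2 * τ) } := by
  set S := { r | ∃ ν : Measure (Ed d), IsP2 ν ∧ r = G ν + (d2sq m ν).toReal / (2 * τ) } with hS
  have hbdd : BddBelow S := bddBelow_hopfLax hLG hG hm hτ
  have hne : S.Nonempty := ⟨_, m, hm, rfl⟩
  set e : ℕ → ℝ := fun n => 1 / ((n : ℝ) + 1) with he
  have he0 (n : ℕ) : 0 < e n := by positivity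
  have he1 (n : ℕ) : e n ≤ 1 := by
    rw [he, div_le_one (by positivity)]
    have := n.cast_nonneg (α := ℝ)
    linarith
  have het : Tendsto e atTop (𝓝 0) := tendsto_one_div_add_atTop_nhds_zero_nat
  have hex (n : ℕ) : ∃ ν π, IsP2 ν ∧ IsCoupling π m ν ∧
      G ν + (transportCost π).toReal / (2 * τ) ≤ sInf S + e n := by
    obtain ⟨_, ⟨ν, hν, rfl⟩, hlt⟩ := exists_lt_of_csInf_lt hne (lt_add_of_pos_right (sInf S) (he0 n))
    obtain ⟨π, hπ, hc⟩ := exists_coupling_lt hm hν (r := (sInf S + e n - G ν) * (2 * τ)) (by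
      rw [← div_lt_iff₀ (by positivity)]
      linarith)
    refine ⟨ν, π, hν, hπ, ?_⟩
    rw [← div_lt_iff₀ (by positivity)] at hc
    linarith
  choose νs πs hν hπ hle using hex
  have hK (n : ℕ) : transportCost (πs n)
      ≤ (((sInf S + 1 - (G m - LG ^ 2 * τ)) * (4 * τ)).toNNReal : ℝ≥0∞) := by
    rw [← ENNReal.ofReal_toReal ((hπ n).transportCost_ne_top hm (hν n))]
    refine ENNReal.ofReal_le_ofReal ?_
    have := coercive_bound hLG hG hm (hν n) hτ ENNReal.toReal_nonneg ((hπ n).d1_le hm (hν n))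
    rw [← div_le_iff₀ (by positivity)]
    linarith [hle n, he1 n]
  obtain ⟨ν, π, φ, hφ, hν', hπ', hd, hc⟩ := exists_subseq_coupling_limit hm hπ hK
  refine ⟨ν, hν', le_antisymm ?_ (csInf_le hbdd ⟨ν, hν', rfl⟩)⟩
  refine le_of_forall_pos_le_add fun δ hδ => ?_
  have hδ' : 0 < δ / (2 * (LG + 1)) := by positivity
  have hev : ∀ᶠ n in atTop,
      (transportCost (πs (φ n))).toReal ≤ (sInf S + δ - G ν) * (2 * τ) := by
    filter_upwards [hd _ hδ',
      (het.comp hφ.tendsto_atTop).eventually (eventually_le_nhds (half_pos hδ))] with n h1 h2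
    have h3 := (abs_le.1 (hG _ _ (hν (φ n)) hν')).1
    have h4 : LG * d1 (νs (φ n)) ν ≤ δ / 2 := by
      refine (mul_le_mul_of_nonneg_left h1 hLG).trans ?_
      rw [← mul_div_assoc, div_le_div_iff₀ (by positivity) (by positivity)]
      nlinarith
    have h5 := hle (φ n)
    simp only [Function.comp_apply] at h2
    rw [← div_le_iff₀ (by positivity)]
    linarith
  have hc' : d2sq m ν ≤ ENNReal.ofReal ((sInf S + δ - G ν) * (2 * τ)) := by
    refine (d2sq_le hπ').trans (hc.trans (liminf_le_of_le (by isBoundedDefault) fun b hb => ?_))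
    obtain ⟨n, hn1, hn2⟩ := (hb.and hev).exists
    rw [← ENNReal.ofReal_toReal ((hπ (φ n)).transportCost_ne_top hm (hν (φ n)))] at hn1
    exact hn1.trans (ENNReal.ofReal_le_ofReal hn2)
  obtain ⟨n, hn⟩ := hev.exists
  have hfin := ENNReal.toReal_le_of_le_ofReal (ENNReal.toReal_nonneg.trans hn) hc'
  rw [← div_le_iff₀ (by positivity)] at hfin
  linarith

lemma d2sq_self {d : ℕ} {m : Measure (Ed d)} (hm : IsP2 m) : d2sq m m = 0 := by
  have := hm.1
  have h := isCoupling_map m (measurable_id (α := Ed d)) measurable_id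
  rw [Measure.map_id] at h
  have h1 := d2sq_le h
  rw [transportCost_map m measurable_id measurable_id] at h1
  simpa using h1

lemma NPval_le {d N : ℕ} (hN : 1 ≤ N) {T t : ℝ} (htT : t < T) {G : Measure (Ed d) → ℝ} {LG : ℝ}
    (hLG : 0 ≤ LG)
    (hG : ∀ μ ν : Measure (Ed d), IsP2 μ → IsP2 ν → |G μ - G ν| ≤ LG * d1 μ ν)
    (x y : Fin N → Ed d) :
    NPval T G t x
      ≤ G (empMeas y) + (1 / (N : ℝ) * ∑ i, ‖x i - y i‖ ^ 2) / (2 * (T - t)) := by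
  have hτ : 0 < T - t := sub_pos.2 htT
  have hN0 : (0 : ℝ) < N := by exact_mod_cast hN
  have hform (y : Fin N → Ed d) : 1 / (2 * (T - t) * (N : ℝ)) * ∑ i, ‖x i - y i‖ ^ 2
      = (1 / (N : ℝ) * ∑ i, ‖x i - y i‖ ^ 2) / (2 * (T - t)) := by
    field_simp
  refine csInf_le ⟨G (empMeas x) - LG ^ 2 * (T - t), ?_⟩ ⟨y, by rw [hform]⟩
  rintro _ ⟨z, rfl⟩
  have := isProbabilityMeasure_unifFin hN
  have hc := isCoupling_map (unifFin N) (measurable_of_finite x) (measurable_of_finite z)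
  rw [map_unifFin, map_unifFin] at hc
  have hd := hc.d1_le (isP2_empMeas hN x) (isP2_empMeas hN z)
  have h0 : 0 ≤ 1 / (N : ℝ) * ∑ i, ‖x i - z i‖ ^ 2 := by positivity
  rw [transportCost_unifFin] at hd
  have h1 := coercive_bound hLG hG (isP2_empMeas hN x) (isP2_empMeas hN z) hτ h0 hd
  have h2 := div_nonneg h0 (by positivity : 0 ≤ 4 * (T - t))
  rw [hform]
  linarith

lemma quantErr_le {d N : ℕ} (y : Fin N → Ed d) (ν : Measure (Ed d)) :
    quantErr N ν ≤ d2 (empMeas y) ν :=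
  ciInf_le ⟨0, by rintro _ ⟨z, rfl⟩; exact Real.sqrt_nonneg _⟩ y

lemma quantErr_nonneg {d N : ℕ} (ν : Measure (Ed d)) : 0 ≤ quantErr N ν :=
  Real.iInf_nonneg fun _ => Real.sqrt_nonneg _

lemma sq_d2 {d : ℕ} (μ ν : Measure (Ed d)) : d2 μ ν ^ 2 = (d2sq μ ν).toReal :=
  Real.sq_sqrt ENNReal.toReal_nonneg

lemma exists_coupling_sqrt_lt {d : ℕ} {μ ν : Measure (Ed d)} (hμ : IsP2 μ) (hν : IsP2 ν) {r : ℝ}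
    (h : d2 μ ν < r) : ∃ π, IsCoupling π μ ν ∧ √(transportCost π).toReal < r := by
  have hr : 0 < r := (Real.sqrt_nonneg _).trans_lt h
  obtain ⟨π, hπ, hc⟩ := exists_coupling_lt hμ hν ((Real.sqrt_lt' hr).1 h)
  exact ⟨π, hπ, (Real.sqrt_lt' hr).2 hc⟩

lemma NPval_le_add_quantErr {d N : ℕ} (hN : 1 ≤ N) {T t : ℝ} (htT : t < T)
    {G : Measure (Ed d) → ℝ} {LG : ℝ} (hLG : 0 ≤ LG)
    (hG : ∀ μ ν : Measure (Ed d), IsP2 μ → IsP2 ν → |G μ - G ν| ≤ LG * d1 μ ν)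
    (x : Fin N → Ed d) {ν : Measure (Ed d)} (hν : IsP2 ν) :
    NPval T G t x ≤ G ν + LG * quantErr N ν
      + (d2 (empMeas x) ν + quantErr N ν) ^ 2 / (2 * (T - t)) := by
  have hτ : 0 < T - t := sub_pos.2 htT
  have hx := isP2_empMeas hN x
  set D := d2 (empMeas x) ν
  set ε := quantErr N ν with hε
  have key (δ : ℝ) (hδ : 0 < δ) :
      NPval T G t x ≤ G ν + LG * (ε + δ) + (D + δ + (ε + δ)) ^ 2 / (2 * (T - t)) := by
    obtain ⟨y, hy⟩ := exists_lt_of_ciInf_lt (lt_add_of_pos_right ε hδ)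
    have hyP := isP2_empMeas hN y
    obtain ⟨π₁, h₁, c₁⟩ := exists_coupling_sqrt_lt hx hν (lt_add_of_pos_right D hδ)
    obtain ⟨π₂, h₂, c₂⟩ := exists_coupling_sqrt_lt hyP hν hy
    obtain ⟨σ, hσ⟩ := exists_perm_sum_norm_sub_sq_le hN hν h₁ h₂
    have h3 := NPval_le hN htT hLG hG x fun i => y (σ i)
    rw [empMeas_comp_perm] at h3
    have h4 := (abs_le.1 (hG _ _ hyP hν)).2
    have h5 : LG * d1 (empMeas y) ν ≤ LG * (ε + δ) :=
      mul_le_mul_of_nonneg_left ((d1_le_d2 hyP hν).trans hy.le) hLG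
    have h6 : (1 / (N : ℝ) * ∑ i, ‖x i - y (σ i)‖ ^ 2) / (2 * (T - t))
        ≤ (D + δ + (ε + δ)) ^ 2 / (2 * (T - t)) := by
      refine div_le_div_of_nonneg_right (hσ.trans ?_) (by positivity)
      exact pow_le_pow_left₀ (by positivity) (add_le_add c₁.le c₂.le) 2
    linarith
  have hlim : Tendsto (fun δ : ℝ =>
      G ν + LG * (ε + δ) + (D + δ + (ε + δ)) ^ 2 / (2 * (T - t))) (𝓝[>] 0)
      (𝓝 (G ν + LG * (ε + 0) + (D + 0 + (ε + 0)) ^ 2 / (2 * (T - t)))) :=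
    tendsto_nhdsWithin_of_tendsto_nhds (Continuous.tendsto (by fun_prop) 0)
  simp only [add_zero] at hlim
  refine ge_of_tendsto hlim ?_
  filter_upwards [self_mem_nhdsWithin] with δ hδ using key δ hδ

/-- for `G` Lipschitz wrt `d_1`, (i) the Hopf–Lax infimum defining
`U(t, m_x^N)` is attained at some `ν̄ ∈ P_2(ℝ^d)`; and (ii) every such minimizer `ν̄`
satisfies `V^N(t,x) ≤ U(t, m_x^N) + 4 L_G ε_N(ν̄)`. -/
theorem exists_minimizer_and_quantization_bound {d N : ℕ} (hd : 1 ≤ d) (hN : 1 ≤ N)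
    (T : ℝ) (hT : 0 < T)
    (G : Measure (Ed d) → ℝ) (LG : ℝ)
    (hGlip : ∀ μ ν : Measure (Ed d), IsP2 μ → IsP2 ν → |G μ - G ν| ≤ LG * d1 μ ν)
    (t : ℝ) (ht : 0 ≤ t) (htT : t < T) (x : Fin N → Ed d) :
    (∃ νb : Measure (Ed d), IsP2 νb ∧
        G νb + (d2sq (empMeas x) νb).toReal / (2 * (T - t)) = MFval T G t (empMeas x)) ∧
    (∀ νb : Measure (Ed d), IsP2 νb →
        G νb + (d2sq (empMeas x) νb).toReal / (2 * (T - t)) = MFval T G t (empMeas x) →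
        NPval T G t x ≤ MFval T G t (empMeas x) + 4 * LG * quantErr N νb) := by
  have hτ : 0 < T - t := sub_pos.2 htT
  have hLG := lipschitz_const_nonneg hd hGlip
  have hm := isP2_empMeas hN x
  refine ⟨exists_hopfLax_minimizer hLG hGlip hm hτ, fun ν hν hmin => ?_⟩
  have hle : MFval T G t (empMeas x) ≤ G (empMeas x) :=
    csInf_le (bddBelow_hopfLax hLG hGlip hm hτ) ⟨empMeas x, hm, by simp [d2sq_self hm]⟩
  have hV := NPval_le_add_quantErr hN htT hLG hGlip x hν
  rw [← hmin, ← sq_d2] at hle ⊢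
  have hG := (abs_le.1 (hGlip _ _ hm hν)).2
  have hd12 := mul_le_mul_of_nonneg_left (d1_le_d2 hm hν) hLG
  have hεD := quantErr_le x ν
  have hε := quantErr_nonneg (N := N) ν
  set D := d2 (empMeas x) ν
  set ε := quantErr N ν
  have hD0 : 0 ≤ D := hε.trans hεD
  have hD : D ≤ 2 * (T - t) * LG := by
    have h1 : D ^ 2 / (2 * (T - t)) ≤ LG * D := by linarith
    rw [div_le_iff₀ (by positivity)] at h1
    by_contra! h2
    have h3 : 0 < D := lt_of_le_of_lt (by positivity) h2
    nlinarith [mul_lt_mul_of_pos_right h2 h3]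
  have hfin : (D + ε) ^ 2 / (2 * (T - t)) ≤ D ^ 2 / (2 * (T - t)) + 3 * LG * ε := by
    rw [div_add' _ _ _ (by positivity)]
    refine div_le_div_of_nonneg_right ?_ (by positivity)
    nlinarith [mul_le_mul_of_nonneg_left hD hε, mul_le_mul_of_nonneg_left hεD hε]
  linarith

end
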